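/- arXiv:2103.04840 — 3 statements merged into one kernel-verified Lean document; each statement's English description precedes it below -/
import Mathlib

section
/- Let A be a self-dual subgroup of W. Then there exists a group homomorphism ψ_A : A_H → 𝒜^× such that ψ_A((0,t)) = ψ(t) for all t ∈ F; that is, the character ψ of the center extends to a character of the subgroup A_H = A × F of the Heisenberg group H. -/
set_option maxHeartbeats 1000000
set_option synthInstance.maxHeartbeats 1000000

noncomputable section

open scoped TensorProduct

/-! ## The base ring `𝒜`: the integral closure of `ℤ[1/p]` in a cyclotomic field -/

instance cycloAlgebra (p : ℕ) [NeZero p] (m : ℕ+) :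
    Algebra (Localization.Away (p : ℤ)) (CyclotomicField m ℚ) :=
  (Localization.awayLift (algebraMap ℤ (CyclotomicField m ℚ)) _
    (by
      rw [map_natCast]
      have h1 : IsUnit ((p : ℕ) : ℚ) :=
        isUnit_iff_ne_zero.mpr (Nat.cast_ne_zero.mpr (NeZero.ne p))
      have h2 := h1.map (algebraMap ℚ (CyclotomicField m ℚ))
      rwa [map_natCast] at h2)).toAlgebra

/-- The integral closure of `ℤ[1/p]` in the `m`-th cyclotomic field `ℚ(ζ_m)`. -/
def Aint (p : ℕ) [NeZero p] (m : ℕ+) :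
    Subalgebra (Localization.Away (p : ℤ)) (CyclotomicField m ℚ) :=
  integralClosure (Localization.Away (p : ℤ)) (CyclotomicField m ℚ)

/-- The ring `𝒜` associated to a finite field of characteristic `p` : the integral
closure of `ℤ[1/p]` in `ℚ(ζ_p)`. -/
def AA (p : ℕ+) : Type := ↥(Aint (p : ℕ) p)

instance (p : ℕ+) : CommRing (AA p) := inferInstanceAs (CommRing ↥(Aint (p : ℕ) p))

attribute [irreducible] AA

/-! ## The Heisenberg group -/

variable {F : Type*} [Field F] {W : Type*} [AddCommGroup W] [Module F W]

/-- The Heisenberg group attached to the bilinear form `β` : the set `W × F` with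
multiplication `(w,t)(w',t') = (w+w', t+t'+½⟨w,w'⟩)`. -/
@[ext]
structure Heis (β : W →ₗ[F] W →ₗ[F] F) : Type _ where
  w : W
  t : F

namespace Heis

variable {β : W →ₗ[F] W →ₗ[F] F}

instance : Mul (Heis β) :=
  ⟨fun a b => ⟨a.w + b.w, a.t + b.t + (2 : F)⁻¹ * β a.w b.w⟩⟩

instance : One (Heis β) := ⟨⟨0, 0⟩⟩

instance : Inv (Heis β) :=
  ⟨fun a => ⟨-a.w, -a.t + (2 : F)⁻¹ * β a.w a.w⟩⟩

@[simp] lemma mul_w (a b : Heis β) : (a * b).w = a.w + b.w := rfl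
@[simp] lemma mul_t (a b : Heis β) :
    (a * b).t = a.t + b.t + (2 : F)⁻¹ * β a.w b.w := rfl
@[simp] lemma one_w : (1 : Heis β).w = 0 := rfl
@[simp] lemma one_t : (1 : Heis β).t = 0 := rfl
@[simp] lemma inv_w (a : Heis β) : a⁻¹.w = -a.w := rfl
@[simp] lemma inv_t (a : Heis β) :
    a⁻¹.t = -a.t + (2 : F)⁻¹ * β a.w a.w := rfl

instance : Group (Heis β) where
  mul_assoc a b c := by
    ext
    · simp [add_assoc]
    · simp [map_add, LinearMap.add_apply]
      ring
  one_mul a := by ext <;> simp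
  mul_one a := by ext <;> simp
  inv_mul_cancel a := by
    ext
    · simp
    · simp [map_neg, LinearMap.neg_apply]

end Heis

/-! ## The induced representation `V_A^ℬ = ind_{A_H}^H(ψ_A^ℬ)` -/

/-- The compactly induced representation `ind_{A_H}^H ψ_A^ℬ`, realised as the
`ℬ`-submodule of functions `f : H → ℬ` with `f(ah) = ψ_A^ℬ(a) f(h)` for `a ∈ A_H`. -/
def IndV (β : W →ₗ[F] W →ₗ[F] F) (ℬ : Type*) [CommRing ℬ] (A : AddSubgroup W)
    (χ : Heis β → ℬˣ) : Submodule ℬ (Heis β → ℬ) where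
  carrier := {f | ∀ a : Heis β, a.w ∈ A → ∀ h : Heis β, f (a * h) = (χ a : ℬ) * f h}
  add_mem' := by
    intro f g hf hg a ha h
    simp only [Pi.add_apply, hf a ha h, hg a ha h, mul_add]
  zero_mem' := by intro a ha h; simp
  smul_mem' := by
    intro c f hf a ha h
    simp only [Pi.smul_apply, smul_eq_mul, hf a ha h]
    ring

/-- Right translation action of `h₀ ∈ H` on functions `H → ℬ`. -/
def hAct (β : W →ₗ[F] W →ₗ[F] F) (ℬ : Type*) [CommRing ℬ] (h₀ : Heis β) :
    (Heis β → ℬ) →ₗ[ℬ] (Heis β → ℬ) where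
  toFun f := fun h => f (h * h₀)
  map_add' _ _ := rfl
  map_smul' _ _ := rfl

lemma hAct_mem (β : W →ₗ[F] W →ₗ[F] F) (ℬ : Type*) [CommRing ℬ] (A : AddSubgroup W)
    (χ : Heis β → ℬˣ) (h₀ : Heis β) (f : Heis β → ℬ) (hf : f ∈ IndV β ℬ A χ) :
    hAct β ℬ h₀ f ∈ IndV β ℬ A χ := by
  intro a ha h
  simpa [hAct, mul_assoc] using hf a ha (h * h₀)

/-- The action `ρ` of the Heisenberg group on `V_A^ℬ`. -/
def hActV (β : W →ₗ[F] W →ₗ[F] F) (ℬ : Type*) [CommRing ℬ] (A : AddSubgroup W)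
    (χ : Heis β → ℬˣ) (h₀ : Heis β) :
    ↥(IndV β ℬ A χ) →ₗ[ℬ] ↥(IndV β ℬ A χ) :=
  (hAct β ℬ h₀).restrict fun f hf => hAct_mem β ℬ A χ h₀ f hf

/-! ## The symplectic group and its action on the Heisenberg group -/

/-- Action of a linear automorphism `g` on the Heisenberg group: `g·(w,t) = (gw,t)`. -/
def gHeis (β : W →ₗ[F] W →ₗ[F] F) (g : W ≃ₗ[F] W) : Heis β → Heis β :=
  fun h => ⟨g h.w, h.t⟩

/-- The symplectic group `Sp(W)` of the form `β`, as a subgroup of the linear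
automorphism group of `W`. -/
def SpGrp (β : W →ₗ[F] W →ₗ[F] F) : Subgroup (W ≃ₗ[F] W) where
  carrier := {g | ∀ u v : W, β (g u) (g v) = β u v}
  one_mem' := fun _ _ => rfl
  mul_mem' := by
    intro g g' hg hg' u v
    have h : ∀ x, (g * g') x = g (g' x) := fun _ => rfl
    rw [h, h, hg, hg']
  inv_mem' := by
    intro g hg u v
    have h1 := hg (g⁻¹ u) (g⁻¹ v)
    have h2 : ∀ x, g (g⁻¹ x) = x := fun x => g.apply_symm_apply x
    rw [h2, h2] at h1
    exact h1.symm

/-- The defining condition of the metaplectic group over `ℬ` : pairs `(g, M)` with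
`g ∈ Sp(W)` and `M ∘ ρ(h) = ρ(g·h) ∘ M` for all `h ∈ H`. -/
def MetaCond (β : W →ₗ[F] W →ₗ[F] F) (ℬ : Type*) [CommRing ℬ] (A : AddSubgroup W)
    (χ : Heis β → ℬˣ)
    (x : (W ≃ₗ[F] W) × (↥(IndV β ℬ A χ) ≃ₗ[ℬ] ↥(IndV β ℬ A χ))) : Prop :=
  (∀ u v : W, β (x.1 u) (x.1 v) = β u v) ∧
    ∀ (h₀ : Heis β) (f : ↥(IndV β ℬ A χ)),
      x.2 (hActV β ℬ A χ h₀ f) = hActV β ℬ A χ (gHeis β x.1 h₀) (x.2 f)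

/-- The character `ψ_A^ℬ = φ ∘ ψ_A` of `A_H` with values in `ℬˣ`, obtained from a
character with values in `𝒜ˣ` via the structure morphism `φ : 𝒜 → ℬ`. -/
def chB (p : ℕ+) (ℬ : Type*) [CommRing ℬ] [Algebra (AA p) ℬ]
    {β : W →ₗ[F] W →ₗ[F] F} (ψA : Heis β → (AA p)ˣ) : Heis β → ℬˣ :=
  fun h => Units.map (algebraMap (AA p) ℬ).toMonoidHom (ψA h)

/-- The character `ψ^ℬ = φ ∘ ψ` of `F` with values in `ℬˣ`. -/
def psB (p : ℕ+) (ℬ : Type*) [CommRing ℬ] [Algebra (AA p) ℬ]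
    (ψ : F → (AA p)ˣ) : F → ℬˣ :=
  fun t => Units.map (algebraMap (AA p) ℬ).toMonoidHom (ψ t)

/-- For a self-dual subgroup `A` of `W`, the character `ψ` of the
center extends to a character `ψ_A : A_H → 𝒜ˣ` of the subgroup `A_H = A × F` of the
Heisenberg group. -/
theorem statement_16
    (p : ℕ+) [Fact (Nat.Prime (p : ℕ))] (hp2 : (p : ℕ) ≠ 2)
    {F : Type*} [Field F] [Fintype F] [CharP F (p : ℕ)]
    {W : Type*} [AddCommGroup W] [Module F W] [FiniteDimensional F W]
    (β : W →ₗ[F] W →ₗ[F] F)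
    (halt : ∀ v : W, β v v = 0)
    (hnd : ∀ v : W, (∀ u : W, β v u = 0) → v = 0)
    (ψ : F → (AA p)ˣ) (hψ : ∀ x y : F, ψ (x + y) = ψ x * ψ y)
    (hψnt : ∃ x : F, ψ x ≠ 1)
    (A : AddSubgroup W)
    (hA : ∀ v : W, (∀ a ∈ A, ψ (β v a) = 1) ↔ v ∈ A) :
    ∃ ψA : Heis β → (AA p)ˣ,
      (∀ a b : Heis β, a.w ∈ A → b.w ∈ A → ψA (a * b) = ψA a * ψA b) ∧
      (∀ t : F, ψA ⟨0, t⟩ = ψ t) := by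
  refine ⟨fun h => ψ h.t, fun a b ha hb => ?_, fun t => rfl⟩
  -- `½` is the image of an integer, so `½ b` again lies in `A`.
  obtain ⟨k, hk⟩ := (Fact.out : Nat.Prime (p : ℕ)).odd_of_ne_two hp2
  have h2k : (2 : F) * ((k + 1 : ℕ) : F) = 1 := by
    have h0 : ((2 * k + 1 : ℕ) : F) = 0 := hk ▸ CharP.cast_eq_zero F (p : ℕ)
    push_cast at h0 ⊢
    linear_combination h0
  have hhalf : (2 : F)⁻¹ * β a.w b.w = β a.w ((k + 1) • b.w) := by
    rw [map_nsmul, nsmul_eq_mul, inv_eq_of_mul_eq_one_right h2k]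
  simp only [Heis.mul_t, hψ]
  rw [hhalf, (hA a.w).mpr ha _ (A.nsmul_mem hb (k + 1)), mul_one]
end
end

section
/- For every w ∈ W let χ_w ∈ V_A^ℬ denote the unique function supported on the coset A_H·(w,0) with χ_w((w,0)) = 1 that is determined by equivariance, explicitly χ_w(h) = ψ_A^ℬ(a) if h = a(w,0) with a ∈ A_H, and χ_w(h) = 0 if h ∉ A_H(w,0). Then for every f ∈ V_A^ℬ and every w ∈ W, the element f((w,0))·χ_w belongs to the ℬ[H]-submodule ℬ[H]·f generated by f. -/
set_option maxHeartbeats 1000000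
set_option synthInstance.maxHeartbeats 1000000

noncomputable section

open scoped TensorProduct

/-! ## The Heisenberg group -/

variable {F : Type*} [Field F] {W : Type*} [AddCommGroup W] [Module F W]

open Classical in
/-- The function `χ_w ∈ V_A^ℬ` supported on the coset `A_H·(w,0)`, determined by
equivariance and `χ_w((w,0)) = 1`. -/
noncomputable def chiW {F : Type*} [Field F] {W : Type*} [AddCommGroup W] [Module F W]
    (β : W →ₗ[F] W →ₗ[F] F) (ℬ : Type*) [CommRing ℬ] (A : AddSubgroup W)
    (χ : Heis β → ℬˣ) (w : W) : Heis β → ℬ := fun h =>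
  if h.w - w ∈ A then (χ (h * (⟨w, 0⟩ : Heis β)⁻¹) : ℬ) else 0

/-- `𝒜` is a domain, being a subring of a field. -/
instance isDomain_AA (p : ℕ+) : IsDomain (AA p) := by
  with_unfolding_all exact inferInstanceAs (IsDomain ↥(Aint (p : ℕ) p))

/-- The prime `p` is invertible in `𝒜`. -/
lemma isUnit_natCast_AA (p : ℕ+) : IsUnit ((p : ℕ) : AA p) := by
  have h : IsUnit (((p : ℕ) : ↥(Aint (p : ℕ) p))) := by
    have := (IsLocalization.Away.algebraMap_isUnit (S := Localization.Away ((p : ℕ) : ℤ))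
      ((p : ℕ) : ℤ)).map (algebraMap _ ↥(Aint (p : ℕ) p))
    simpa only [Int.cast_natCast, map_natCast] using this
  with_unfolding_all exact h

/-- The number of elements of a subgroup of a finite-dimensional space over a finite field of
characteristic `p` is invertible in every `𝒜`-algebra. -/
lemma isUnit_natCard_addSubgroup (p : ℕ+) [Fact (Nat.Prime (p : ℕ))]
    {F : Type*} [Field F] [Finite F] [CharP F (p : ℕ)]
    {W : Type*} [AddCommGroup W] [Module F W] [FiniteDimensional F W]
    (ℬ : Type*) [CommRing ℬ] [Algebra (AA p) ℬ] (A : AddSubgroup W) :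
    IsUnit (Nat.card A : ℬ) := by
  have := Fintype.ofFinite F
  have hp : IsUnit ((p : ℕ) : ℬ) := by
    simpa using (isUnit_natCast_AA p).map (algebraMap (AA p) ℬ)
  obtain ⟨n, -, hn⟩ := FiniteField.card F (p : ℕ)
  have hW : IsUnit (Nat.card W : ℬ) := by
    rw [Module.natCard_eq_pow_finrank (K := F), Nat.card_eq_fintype_card, hn]
    push_cast
    exact (hp.pow _).pow _
  exact isUnit_of_dvd_unit (Nat.cast_dvd_cast A.card_addSubgroup_dvd_card) hW

/-- A nontrivial character of a finite additive group with values in a domain sums to zero. -/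
lemma sum_units_eq_zero_of_ne_one {G R : Type*} [AddCommGroup G] [Fintype G] [CommRing R]
    [IsDomain R] (χ : G → Rˣ) (hχ : ∀ a b, χ (a + b) = χ a * χ b) {g : G} (hg : χ g ≠ 1) :
    ∑ a, (χ a : R) = 0 := by
  have h : (χ g : R) * ∑ a, (χ a : R) = ∑ a, (χ a : R) := by
    rw [Finset.mul_sum, ← Equiv.sum_comp (Equiv.addLeft g) fun a => (χ a : R)]
    simp [hχ]
  have h' : ((χ g : R) - 1) * ∑ a, (χ a : R) = 0 := by rw [sub_mul, one_mul, h, sub_self]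
  refine (mul_eq_zero.mp h').resolve_left fun h0 => hg ?_
  exact Units.ext (sub_eq_zero.mp h0)

/-- Conjugating `(a,0)` by `h(w,0)⁻¹` changes it by a central element. -/
lemma Heis.mul_conj {β : W →ₗ[F] W →ₗ[F] F} (h2 : (2 : F) ≠ 0) (halt : ∀ v : W, β v v = 0)
    (h : Heis β) (a w : W) :
    h * ((⟨w, 0⟩ : Heis β)⁻¹ * ⟨a, 0⟩ * ⟨w, 0⟩) = ⟨0, β (h.w - w) a⟩ * ⟨a, 0⟩ * h := by
  have hs : ∀ u v : W, β u v = -β v u := fun u v => by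
    have := halt (u + v)
    simp only [map_add, LinearMap.add_apply, halt] at this
    linear_combination this
  ext
  · simp only [mul_w, inv_w]
    abel
  · simp only [mul_w, mul_t, inv_w, inv_t, map_add, map_neg, map_sub, map_zero,
      LinearMap.add_apply, LinearMap.neg_apply, LinearMap.sub_apply, LinearMap.zero_apply, halt]
    rw [hs a h.w, hs a w]
    field_simp
    ring

/-- For every `f ∈ V_A^ℬ` and every `w ∈ W`, the element
`f((w,0))·χ_w` belongs to the `ℬ[H]`-submodule `ℬ[H]·f` generated by `f`,
i.e. to the `ℬ`-span of the `H`-translates of `f`. -/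
theorem statement_17
    (p : ℕ+) [Fact (Nat.Prime (p : ℕ))] (hp2 : (p : ℕ) ≠ 2)
    {F : Type*} [Field F] [Fintype F] [CharP F (p : ℕ)]
    {W : Type*} [AddCommGroup W] [Module F W] [FiniteDimensional F W]
    (β : W →ₗ[F] W →ₗ[F] F)
    (halt : ∀ v : W, β v v = 0)
    (hnd : ∀ v : W, (∀ u : W, β v u = 0) → v = 0)
    (ℬ : Type*) [CommRing ℬ] [Algebra (AA p) ℬ]
    (ψ : F → (AA p)ˣ) (hψ : ∀ x y : F, ψ (x + y) = ψ x * ψ y)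
    (hψnt : ∃ x : F, ψ x ≠ 1)
    (A : AddSubgroup W)
    (hA : ∀ v : W, (∀ a ∈ A, ψ (β v a) = 1) ↔ v ∈ A)
    (ψA : Heis β → (AA p)ˣ)
    (hψA : ∀ a b : Heis β, a.w ∈ A → b.w ∈ A → ψA (a * b) = ψA a * ψA b)
    (hψAext : ∀ t : F, ψA ⟨0, t⟩ = ψ t) :
    ∀ f ∈ IndV β ℬ A (chB p ℬ ψA), ∀ w : W,
      (f (⟨w, 0⟩ : Heis β)) • chiW β ℬ A (chB p ℬ ψA) w ∈
        Submodule.span ℬ (Set.range fun h₀ : Heis β => hAct β ℬ h₀ f) := by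
  classical
  intro f hf w
  have h2 : (2 : F) ≠ 0 :=
    Ring.two_ne_zero (by rwa [ringChar.eq F (p : ℕ)])
  have : Finite W := Module.finite_of_finite F
  have := Fintype.ofFinite A
  set χ : Heis β → ℬˣ := chB p ℬ ψA with hχ
  have hcard : IsUnit (Fintype.card A : ℬ) := by
    rw [← Nat.card_eq_fintype_card]
    exact isUnit_natCard_addSubgroup p (F := F) ℬ A
  have hact : ∀ (a : A) (h : Heis β),
      ((χ ⟨a, 0⟩)⁻¹ : ℬˣ) * f (h * ((⟨w, 0⟩ : Heis β)⁻¹ * ⟨a, 0⟩ * ⟨w, 0⟩)) =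
        algebraMap (AA p) ℬ (ψ (β (h.w - w) a)) * f h := fun a h => by
    rw [Heis.mul_conj h2 halt, mul_assoc, hf _ A.zero_mem, hf _ a.2]
    have : (chB p ℬ ψA ⟨0, β (h.w - w) a⟩ : ℬ) = algebraMap (AA p) ℬ (ψ (β (h.w - w) a)) := by
      rw [← hψAext]
      rfl
    rw [this, mul_left_comm, Units.inv_mul_cancel_left]
  have hsum : ∑ a : A, ((χ ⟨a, 0⟩)⁻¹ : ℬˣ).val •
      hAct β ℬ ((⟨w, 0⟩ : Heis β)⁻¹ * ⟨a, 0⟩ * ⟨w, 0⟩) f =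
        (Fintype.card A : ℬ) • f ⟨w, 0⟩ • chiW β ℬ A χ w := by
    funext h
    simp only [Finset.sum_apply, Pi.smul_apply, smul_eq_mul, hAct, LinearMap.coe_mk,
      AddHom.coe_mk, hact, chiW]
    rw [← Finset.sum_mul, ← map_sum]
    split_ifs with hmem
    · have hone : ∀ a : A, ψ (β (h.w - w) a) = 1 := fun a => (hA _).mpr hmem a a.2
      have hfh := hf (h * (⟨w, 0⟩ : Heis β)⁻¹) (by simpa [sub_eq_add_neg] using hmem) ⟨w, 0⟩
      rw [inv_mul_cancel_right] at hfh
      simp only [hone, hfh]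
      simp [hχ, mul_comm]
    · have hex : ∃ a : A, ψ (β (h.w - w) a) ≠ 1 := by
        by_contra! hall
        exact hmem ((hA _).mp fun a ha => hall ⟨a, ha⟩)
      obtain ⟨a, ha⟩ := hex
      rw [sum_units_eq_zero_of_ne_one (fun a : A => ψ (β (h.w - w) a))
        (fun a b => by rw [AddSubgroup.coe_add, map_add, hψ]) ha]
      simp
  rw [← Submodule.smul_mem_iff_of_isUnit _ hcard, ← hsum]
  exact Submodule.sum_mem _ fun a _ => Submodule.smul_mem _ _ (Submodule.subset_span ⟨_, rfl⟩)
end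
end

section
/- Let φ : R → S be an injective homomorphism of commutative rings and V a free R-module. Endow V and V ⊗_R S with the discrete topology, and endow the automorphism groups GL_R(V) and GL_S(V ⊗_R S) with the compact-open topology (for discrete module, the topology of pointwise convergence, generated by the sets S_{s,s'} = {M : M s = s'}). Then the base-change group homomorphism GL_R(V) → GL_S(V ⊗_R S), M ↦ M ⊗ id_S, is injective and continuous, and it is a homeomorphism onto its image. -/
noncomputable section

open scoped TensorProduct

/-- The compact-open topology on the automorphism group of a discretely topologised
module: the topology of pointwise convergence, generated by the prebasis of sets
`S_{s,s'} = {M : M s = s'}`. -/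
def glTop (R V : Type*) [CommRing R] [AddCommGroup V] [Module R V] :
    TopologicalSpace (V ≃ₗ[R] V) :=
  TopologicalSpace.generateFrom
    {U : Set (V ≃ₗ[R] V) | ∃ s s' : V, U = {M : V ≃ₗ[R] V | M s = s'}}

/-- The map `v ↦ 1 ⊗ v` is injective for flat `V` when `R → S` is injective. -/
theorem one_tmul_injective {R S V : Type*} [CommRing R] [CommRing S] [Algebra R S]
    [AddCommGroup V] [Module R V] [Module.Flat R V]
    (hφ : Function.Injective (algebraMap R S)) :
    Function.Injective (fun v : V => (1 : S) ⊗ₜ[R] v) := by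
  have := (faithfulSMul_iff_algebraMap_injective R S).2 hφ
  exact Module.Flat.tensorProduct_mk_injective R V S

theorem eventually_apply_eq {R V : Type*} [CommRing R] [AddCommGroup V] [Module R V]
    (M : V ≃ₗ[R] V) (v : V) : ∀ᶠ N in @nhds _ (glTop R V) M, N v = M v :=
  let _ := glTop R V
  (TopologicalSpace.isOpen_generateFrom_of_mem ⟨v, M v, rfl⟩ :
    IsOpen {N : V ≃ₗ[R] V | N v = M v}).mem_nhds rfl

theorem eventually_baseChange_apply_eq {R : Type*} (S : Type*) {V : Type*} [CommRing R]
    [CommRing S] [Algebra R S] [AddCommGroup V] [Module R V]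
    (M : V ≃ₗ[R] V) (t : S ⊗[R] V) :
    ∀ᶠ N in @nhds _ (glTop R V) M,
      LinearEquiv.baseChange R S V V N t = LinearEquiv.baseChange R S V V M t := by
  induction t with
  | zero => simp
  | tmul s v =>
    filter_upwards [eventually_apply_eq M v] with N hN
    simp [LinearEquiv.baseChange, hN]
  | add x y hx hy =>
    filter_upwards [hx, hy] with N hNx hNy
    rw [map_add, map_add, hNx, hNy]

theorem continuous_baseChange (R S V : Type*) [CommRing R] [CommRing S] [Algebra R S]
    [AddCommGroup V] [Module R V] :
    @Continuous _ _ (glTop R V) (glTop S (S ⊗[R] V))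
      (fun M : V ≃ₗ[R] V => LinearEquiv.baseChange R S V V M) := by
  let _ := glTop R V
  refine continuous_generateFrom_iff.2 ?_
  rintro _ ⟨t, t', rfl⟩
  refine isOpen_iff_mem_nhds.2 fun M hM => ?_
  filter_upwards [eventually_baseChange_apply_eq S M t] with N hN
  exact hN.trans hM

theorem baseChange_apply_one_tmul_eq_iff {R S V : Type*} [CommRing R] [CommRing S]
    [Algebra R S] [AddCommGroup V] [Module R V] [Module.Flat R V]
    (hφ : Function.Injective (algebraMap R S)) (M : V ≃ₗ[R] V) (v w : V) :
    LinearEquiv.baseChange R S V V M (1 ⊗ₜ v) = 1 ⊗ₜ w ↔ M v = w :=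
  (one_tmul_injective (S := S) hφ).eq_iff (a := M v) (b := w)

theorem baseChange_injective {R S V : Type*} [CommRing R] [CommRing S]
    [Algebra R S] [AddCommGroup V] [Module R V] [Module.Flat R V]
    (hφ : Function.Injective (algebraMap R S)) :
    Function.Injective
      (fun M : V ≃ₗ[R] V => LinearEquiv.baseChange R S V V M) := fun M N h =>
  LinearEquiv.ext fun v => (baseChange_apply_one_tmul_eq_iff hφ M v (N v)).1 <|
    (LinearEquiv.congr_fun h (1 ⊗ₜ v)).trans
      ((baseChange_apply_one_tmul_eq_iff hφ N v (N v)).2 rfl)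

/-- Let `φ : R → S` be an injective homomorphism of commutative rings
and `V` a free `R`-module. With the compact-open (pointwise-convergence) topologies on
`GL_R(V)` and `GL_S(V ⊗_R S)`, the base-change homomorphism `M ↦ M ⊗ id_S` is injective,
continuous, and a homeomorphism onto its image (an embedding). -/
theorem statement_19 {R S V : Type*} [CommRing R] [CommRing S] [Algebra R S]
    [AddCommGroup V] [Module R V] [Module.Free R V]
    (hφ : Function.Injective (algebraMap R S)) :
    Function.Injective
      (fun M : V ≃ₗ[R] V => LinearEquiv.baseChange R S V V M) ∧
    @Continuous _ _ (glTop R V) (glTop S (S ⊗[R] V))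
      (fun M : V ≃ₗ[R] V => LinearEquiv.baseChange R S V V M) ∧
    @Topology.IsEmbedding _ _ (glTop R V) (glTop S (S ⊗[R] V))
      (fun M : V ≃ₗ[R] V => LinearEquiv.baseChange R S V V M) := by
  refine ⟨baseChange_injective hφ, continuous_baseChange R S V, ?_⟩
  let _ := glTop R V
  let _ := glTop S (S ⊗[R] V)
  refine ⟨⟨le_antisymm (continuous_baseChange R S V).le_induced ?_⟩, baseChange_injective hφ⟩
  refine le_generateFrom ?_
  rintro _ ⟨v, w, rfl⟩
  refine isOpen_induced_iff.2 ⟨_, TopologicalSpace.isOpen_generateFrom_of_mem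
    ⟨1 ⊗ₜ v, 1 ⊗ₜ w, rfl⟩, ?_⟩
  ext M
  exact baseChange_apply_one_tmul_eq_iff hφ M v w
end
end
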